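/- (Mildenberger) If U0 and U1 are two non-isomorphic Ramsey ultrafilters on ℕ, then the family FIN^[∞](⟨U0,U1⟩) is Matet-adequate. -/

import Mathlib

/-- `blockLt s t` means every element of `s` is below every element of `t`
(for nonempty finite sets this is `max s < min t`). -/
def blockLt (s t : Finset ℕ) : Prop := ∀ a ∈ s, ∀ b ∈ t, a < b

/-- An infinite block sequence: a sequence of nonempty finite sets of naturals,
each block entirely below the next. -/
def IsBlockSeq (X : ℕ → Finset ℕ) : Prop :=
  ∀ i, (X i).Nonempty ∧ blockLt (X i) (X (i + 1))

/-- A finite block sequence of length `n`. -/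
def IsFinBlockSeq {n : ℕ} (a : Fin n → Finset ℕ) : Prop :=
  (∀ i, (a i).Nonempty) ∧ ∀ i j : Fin n, i < j → blockLt (a i) (a j)

/-- `s ∈ [X]`: `s` is the union of the blocks `X i` for `i` in some nonempty finite set. -/
def InUnions (X : ℕ → Finset ℕ) (s : Finset ℕ) : Prop :=
  ∃ I : Finset ℕ, I.Nonempty ∧ s = I.biUnion X

/-- `Y ≤ X`: `Y` is a condensation of `X`, i.e. every block of `Y` is in `[X]`. -/
def Condensation (Y X : ℕ → Finset ℕ) : Prop := ∀ n, InUnions X (Y n)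

/-- `Y ≤* X`: some tail of `Y` (all blocks whose elements exceed some `m`)
is a condensation of `X`. -/
def CondensationStar (Y X : ℕ → Finset ℕ) : Prop :=
  ∃ m : ℕ, ∀ i, (∀ a ∈ Y i, m < a) → InUnions X (Y i)

/-- A nonempty family `H ⊆ FIN^[∞]` is Matet-adequate. -/
def MatetAdequate (H : Set (ℕ → Finset ℕ)) : Prop :=
  H.Nonempty ∧
  (∀ X ∈ H, IsBlockSeq X) ∧
  -- (i) closed under finite changes
  (∀ Y ∈ H, ∀ X : ℕ → Finset ℕ, IsBlockSeq X → {n | X n ≠ Y n}.Finite → X ∈ H) ∧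
  -- (ii) closed ≤*-upwards
  (∀ Y ∈ H, ∀ X : ℕ → Finset ℕ, IsBlockSeq X → CondensationStar Y X → X ∈ H) ∧
  -- (iii) ≤-descending sequences have ≤*-lower bounds in H
  (∀ f : ℕ → ℕ → Finset ℕ, (∀ n, f n ∈ H) → (∀ n, Condensation (f (n + 1)) (f n)) →
    ∃ X ∈ H, ∀ n, CondensationStar X (f n)) ∧
  -- (iv) Hindman property relative to H
  (∀ X ∈ H, ∀ c : Finset ℕ → Fin 2, ∃ Y ∈ H, Condensation Y X ∧
    ∃ j : Fin 2, ∀ s : Finset ℕ, InUnions Y s → c s = j)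

/-- A (ultra)filter is free if it contains no finite set, equivalently
every member is infinite. -/
def FreeUf {S : Type} (U : Ultrafilter S) : Prop := ∀ A ∈ U, Set.Infinite A

/-- Isomorphism of ultrafilters: some bijection maps one to the other. -/
def UfIso {S T : Type} (U : Ultrafilter S) (V : Ultrafilter T) : Prop :=
  ∃ f : S ≃ T, Ultrafilter.map f U = V

/-- A Ramsey ultrafilter on ℕ: free, and every 2-coloring of pairs has a
monochromatic member. -/
def IsRamseyUf (U : Ultrafilter ℕ) : Prop :=
  FreeUf U ∧ ∀ c : ℕ → ℕ → Fin 2, ∃ A : Set ℕ, A ∈ U ∧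
    ∃ j : Fin 2, ∀ x ∈ A, ∀ y ∈ A, x < y → c x y = j

/-- A Q-point on ℕ: free, and for every partition of ℕ into finite sets
(encoded as a finite-to-one function, whose fibers are the pieces) there is a
member meeting each piece in at most one point. -/
def IsQPointUf (U : Ultrafilter ℕ) : Prop :=
  FreeUf U ∧ ∀ f : ℕ → ℕ, (∀ m, (f ⁻¹' {m}).Finite) →
    ∃ A : Set ℕ, A ∈ U ∧ Set.InjOn f A

/-- Mildenberger's family `FIN^[∞](⟨U0,U1⟩)`. -/
def FINinfPair (U0 U1 : Ultrafilter ℕ) : Set (ℕ → Finset ℕ) :=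
  {X | IsBlockSeq X ∧ ∀ A : Set ℕ, A ∈ U0 → ∀ B : Set ℕ, B ∈ U1 →
    ∃ Y : ℕ → Finset ℕ, ∃ hY : IsBlockSeq Y, Condensation Y X ∧
      ∀ n, (Y n).min' (hY n).1 ∈ A ∧ (Y n).max' (hY n).1 ∈ B}

open Filter

theorem FreeUf.eventually_gt {U : Ultrafilter ℕ} (h : FreeUf U) (N : ℕ) : ∀ᶠ x in U, N < x := by
  by_contra hN
  rw [← Ultrafilter.eventually_not] at hN
  exact h _ hN ((Set.finite_Iic N).subset fun x hx => by simpa using hx)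

theorem FreeUf.infinite_eventually {U : Ultrafilter ℕ} (h : FreeUf U) {A : Set ℕ} (hA : A ∈ U)
    (N : ℕ) : ∃ x ∈ A, N < x := by
  obtain ⟨x, hx⟩ := Ultrafilter.nonempty_of_mem (inter_mem hA (h.eventually_gt N))
  exact ⟨x, hx.1, hx.2⟩

/-- A Ramsey ultrafilter contains a pseudo-intersection of any countable family of its members. -/
theorem IsRamseyUf.exists_pseudoIntersection {U : Ultrafilter ℕ} (h : IsRamseyUf U)
    (S : ℕ → Set ℕ) (hS : ∀ n, S n ∈ U) :
    ∃ A ∈ U, ∃ g : ℕ → ℕ, ∀ n, ∀ x ∈ A, g n < x → x ∈ S n := by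
  classical
  obtain ⟨A, hA, j, hj⟩ := h.2 fun x y => if ∀ n ∈ Finset.range (x + 1), y ∈ S n then 1 else 0
  have hlarge (n : ℕ) : ∃ x ∈ A, n ≤ x :=
    (h.1.infinite_eventually hA n).imp fun x hx => ⟨hx.1, hx.2.le⟩
  choose g hgA hgn using hlarge
  refine ⟨A, hA, g, fun n x hx hgx => ?_⟩
  have hj1 : j = 1 := by
    have hI : ∀ᶠ y in U, ∀ k ∈ Finset.range (g n + 1), y ∈ S k :=
      (eventually_all_finset _).2 fun k _ => hS k
    obtain ⟨y, hy, hgy⟩ := h.1.infinite_eventually (inter_mem hA hI) (g n)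
    exact (hj _ (hgA n) y hy.1 hgy).symm.trans (if_pos hy.2)
  have := hj _ (hgA n) x hx hgx
  rw [hj1] at this
  by_contra hxS
  rw [if_neg] at this
  · exact absurd this (by decide)
  · exact fun H => hxS (H n (Finset.mem_range.2 (Nat.lt_succ_of_le (hgn n))))

theorem IsRamseyUf.isQPointUf {U : Ultrafilter ℕ} (h : IsRamseyUf U) : IsQPointUf U := by
  classical
  refine ⟨h.1, fun f hf => ?_⟩
  obtain ⟨A, hA, j, hj⟩ := h.2 fun x y => if f x = f y then 1 else 0
  refine ⟨A, hA, ?_⟩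
  have hj0 : j = 0 := by
    by_contra hne
    have hj1 : j = 1 := by omega
    obtain ⟨x, hx, -⟩ := h.1.infinite_eventually hA 0
    refine h.1 _ (inter_mem hA (h.1.eventually_gt x)) ((hf (f x)).subset ?_)
    rintro y ⟨hy, hxy⟩
    have := hj x hx y hy hxy
    rw [hj1] at this
    by_contra hfy
    rw [if_neg (fun e => hfy e.symm)] at this
    exact absurd this (by decide)
  have key : ∀ x ∈ A, ∀ y ∈ A, x < y → f x ≠ f y := fun x hx y hy hxy e => by
    have := hj x hx y hy hxy
    rw [if_pos e, hj0] at this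
    exact absurd this (by decide)
  intro x hx y hy e
  rcases lt_trichotomy x y with hxy | hxy | hxy
  · exact absurd e (key x hx y hy hxy)
  · exact hxy
  · exact absurd e.symm (key y hy x hx hxy)

theorem Set.Infinite.exists_infinite_partition {A : Set ℕ} (hA : A.Infinite) :
    ∃ B C : Set ℕ, B ∪ C = A ∧ Disjoint B C ∧ B.Infinite ∧ C.Infinite := by
  obtain ⟨B, C, hBC, hdisj, hcard⟩ := hA.exists_union_disjoint_cardinal_eq_of_infinite
  have hiff : B.Infinite ↔ C.Infinite := by
    rw [← Set.infinite_coe_iff, ← Set.infinite_coe_iff, Cardinal.infinite_iff,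
      Cardinal.infinite_iff, hcard]
  rw [← hBC, Set.infinite_union] at hA
  exact ⟨B, C, hBC, hdisj, hA.elim id hiff.2, hA.elim hiff.1 id⟩

theorem Set.InjOn.exists_equiv_eqOn {f : ℕ → ℕ} {A : Set ℕ} (hf : Set.InjOn f A)
    (hA : Aᶜ.Infinite) (hfA : (f '' A)ᶜ.Infinite) : ∃ e : ℕ ≃ ℕ, Set.EqOn e f A := by
  classical
  have := hA.to_subtype
  have := hfA.to_subtype
  obtain ⟨e'⟩ : Nonempty (↥Aᶜ ≃ ↥(f '' A)ᶜ) := nonempty_equiv_of_countable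
  refine ⟨(Equiv.Set.sumCompl A).symm.trans
    (((Equiv.Set.imageOfInjOn f A hf).sumCongr e').trans (Equiv.Set.sumCompl (f '' A))), ?_⟩
  intro x hx
  simp [Equiv.Set.sumCompl_symm_apply_of_mem hx, Equiv.Set.imageOfInjOn]

/-- Finite-to-one images of Q-points are isomorphic to them. -/
theorem IsQPointUf.exists_equiv_map_eq {U : Ultrafilter ℕ} (h : IsQPointUf U) {f : ℕ → ℕ}
    (hf : ∀ m, (f ⁻¹' {m}).Finite) : ∃ e : ℕ ≃ ℕ, U.map e = U.map f := by
  obtain ⟨A, hA, hinj⟩ := h.2 f hf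
  obtain ⟨B, C, rfl, hdisj, hB, hC⟩ := (h.1 A hA).exists_infinite_partition
  have main : ∀ B C : Set ℕ, Set.InjOn f (B ∪ C) → Disjoint B C → C.Infinite → B ∈ U →
      ∃ e : ℕ ≃ ℕ, U.map e = U.map f := by
    intro B C hinj hdisj hC hBU
    have hfC : f '' C ⊆ (f '' B)ᶜ := by
      rintro _ ⟨c, hc, rfl⟩ ⟨b, hb, hbc⟩
      exact Set.disjoint_left.1 hdisj hb (hinj (Or.inl hb) (Or.inr hc) hbc ▸ hc)
    obtain ⟨e, he⟩ := (hinj.mono Set.subset_union_left).exists_equiv_eqOn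
      (hC.mono hdisj.subset_compl_left)
      ((hC.image (hinj.mono Set.subset_union_right)).mono hfC)
    exact ⟨e, Ultrafilter.coe_injective (Filter.map_congr (mem_of_superset hBU he))⟩
  rcases Ultrafilter.union_mem_iff.1 hA with hBU | hCU
  · exact main B C hinj hdisj hC hBU
  · exact main C B (Set.union_comm B C ▸ hinj) hdisj.symm hB hCU

/-- Finite-to-one maps on non-isomorphic Q-points have disjoint images on suitable members. -/
theorem IsQPointUf.exists_forall_ne {U V : Ultrafilter ℕ} (hU : IsQPointUf U) (hV : IsQPointUf V)
    (hne : ¬ UfIso U V) {f g : ℕ → ℕ} (hf : ∀ m, (f ⁻¹' {m}).Finite)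
    (hg : ∀ m, (g ⁻¹' {m}).Finite) :
    ∃ A ∈ U, ∃ B ∈ V, ∀ a ∈ A, ∀ b ∈ B, f a ≠ g b := by
  obtain ⟨e, he⟩ := hU.exists_equiv_map_eq hf
  obtain ⟨e', he'⟩ := hV.exists_equiv_map_eq hg
  have hmap : U.map f ≠ V.map g := by
    intro h
    refine hne ⟨e.trans e'.symm, ?_⟩
    rw [Equiv.coe_trans, ← Ultrafilter.map_map, he, h, ← he', Ultrafilter.map_map,
      Equiv.symm_comp_self, Ultrafilter.map_id]
  obtain ⟨C, hC, hC'⟩ : ∃ C ∈ U.map f, C ∉ V.map g := by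
    by_contra! H
    exact hmap (Ultrafilter.eq_of_le (f := U.map f) (g := V.map g) fun s hs => by
      by_contra hs'
      have := H sᶜ (Ultrafilter.compl_mem_iff_notMem.2 hs')
      exact Ultrafilter.compl_mem_iff_notMem.1 this hs)
  refine ⟨f ⁻¹' C, hC, g ⁻¹' Cᶜ, Ultrafilter.compl_mem_iff_notMem.2 hC', ?_⟩
  intro a ha b hb hab
  exact hb (hab ▸ ha)

/-- The index `k` with `β k ≤ x < β (k + 1)`, when `β` is strictly increasing and `β 0 ≤ x`. -/
def intervalIndex (β : ℕ → ℕ) (x : ℕ) : ℕ := Nat.findGreatest (fun k => β k ≤ x) x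

theorem apply_intervalIndex_le {β : ℕ → ℕ} {x : ℕ} (hx : β 0 ≤ x) :
    β (intervalIndex β x) ≤ x :=
  Nat.findGreatest_spec (P := fun k => β k ≤ x) (Nat.zero_le x) hx

theorem StrictMono.lt_intervalIndex_succ {β : ℕ → ℕ} (hβ : StrictMono β) (x : ℕ) :
    x < β (intervalIndex β x + 1) := by
  by_contra! h
  have := Nat.le_findGreatest (P := fun k => β k ≤ x) ((hβ.id_le _).trans h) h
  exact absurd this (by simp [intervalIndex])

theorem StrictMono.finite_intervalIndex_fiber {β : ℕ → ℕ} (hβ : StrictMono β) (m : ℕ) :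
    (intervalIndex β ⁻¹' {m}).Finite := by
  refine (Set.finite_Iio (β (m + 1))).subset ?_
  rintro x rfl
  exact hβ.lt_intervalIndex_succ x

theorem StrictMono.intervalIndex_lt {β : ℕ → ℕ} (hβ : StrictMono β) {x k : ℕ} (h0 : β 0 ≤ x)
    (hx : x < β k) : intervalIndex β x < k :=
  hβ.lt_iff_lt.1 ((apply_intervalIndex_le h0).trans_lt hx)

theorem StrictMono.le_intervalIndex {β : ℕ → ℕ} (hβ : StrictMono β) {x k : ℕ}
    (hx : β k ≤ x) : k ≤ intervalIndex β x :=
  Nat.le_of_lt_succ (hβ.lt_iff_lt.1 (hx.trans_lt (hβ.lt_intervalIndex_succ x)))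

/-- Non-isomorphic Q-points have members whose points are pairwise far apart. -/
theorem IsQPointUf.exists_far_apart {U V : Ultrafilter ℕ} (hU : IsQPointUf U) (hV : IsQPointUf V)
    (hne : ¬ UfIso U V) {G : ℕ → ℕ} (hG : Monotone G) (hid : ∀ x, x ≤ G x) :
    ∃ A ∈ U, ∃ B ∈ V, ∀ a ∈ A, ∀ b ∈ B, a ≠ b ∧ (a < b → G a < b) ∧ (b < a → G b < a) := by
  let β : ℕ → ℕ := fun k => Nat.rec (motive := fun _ => ℕ) 0 (fun _ y => G y + 1) k
  have hβs (k : ℕ) : β (k + 1) = G (β k) + 1 := rfl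
  have hβ : StrictMono β := strictMono_nat_of_lt_succ fun k => by
    rw [hβs]; exact Nat.lt_succ_of_le (hid _)
  have hclose : ∀ x y, x < y → y ≤ G x → intervalIndex β x = intervalIndex β y ∨
      intervalIndex β x + 1 = intervalIndex β y := by
    intro x y hxy hy
    have h1 : intervalIndex β x ≤ intervalIndex β y :=
      hβ.le_intervalIndex ((apply_intervalIndex_le (Nat.zero_le _)).trans hxy.le)
    have h2 : intervalIndex β y < intervalIndex β x + 2 := by
      refine hβ.intervalIndex_lt (Nat.zero_le _) ?_
      change y < G (β (intervalIndex β x + 1)) + 1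
      exact Nat.lt_succ_of_le (hy.trans (hG (hβ.lt_intervalIndex_succ x).le))
    omega
  have hfin := hβ.finite_intervalIndex_fiber
  have hfin' : ∀ m, ((fun x => intervalIndex β x + 1) ⁻¹' {m}).Finite := fun m =>
    (hfin (m - 1)).subset fun x hx => by
      simp only [Set.mem_preimage, Set.mem_singleton_iff] at hx ⊢
      omega
  obtain ⟨A₁, hA₁, B₁, hB₁, h₁⟩ := hU.exists_forall_ne hV hne hfin hfin
  obtain ⟨A₂, hA₂, B₂, hB₂, h₂⟩ := hU.exists_forall_ne hV hne hfin' hfin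
  obtain ⟨A₃, hA₃, B₃, hB₃, h₃⟩ := hU.exists_forall_ne hV hne hfin hfin'
  refine ⟨A₁ ∩ (A₂ ∩ A₃), inter_mem hA₁ (inter_mem hA₂ hA₃),
    B₁ ∩ (B₂ ∩ B₃), inter_mem hB₁ (inter_mem hB₂ hB₃), ?_⟩
  rintro a ⟨ha₁, ha₂, ha₃⟩ b ⟨hb₁, hb₂, hb₃⟩
  refine ⟨?_, fun hab => ?_, fun hba => ?_⟩
  · rintro rfl
    exact h₁ a ha₁ a hb₁ rfl
  · by_contra! hle
    exact (hclose a b hab hle).elim (h₁ a ha₁ b hb₁) (h₂ a ha₂ b hb₂)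
  · by_contra! hle
    exact (hclose b a hba hle).elim (fun e => h₁ a ha₁ b hb₁ e.symm)
      (fun e => h₃ a ha₃ b hb₃ e.symm)

/-- Disjoint members of two Q-points can be thinned out so as to alternate. -/
theorem IsQPointUf.exists_alternating {U V : Ultrafilter ℕ} (hU : IsQPointUf U)
    (hV : IsQPointUf V) {A B : Set ℕ} (hA : A ∈ U) (hB : B ∈ V) (hAB : Disjoint A B) :
    ∃ a m : ℕ → ℕ, (∀ i, a i ∈ A) ∧ (∀ i, m i ∈ B) ∧ (∀ i, m i < a i ∧ a i < m (i + 1)) ∧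
      Set.range a ∈ U ∧ Set.range m ∈ V := by
  classical
  have nextA (n : ℕ) : ∃ x ∈ A, n < x ∧ ∀ y ∈ A, n < y → x ≤ y := by
    have h := hU.1.infinite_eventually hA n
    exact ⟨Nat.find h, (Nat.find_spec h).1, (Nat.find_spec h).2,
      fun y hy hny => Nat.find_min' h ⟨hy, hny⟩⟩
  have nextB (n : ℕ) : ∃ x ∈ B, n < x ∧ ∀ y ∈ B, n < y → x ≤ y := by
    have h := hV.1.infinite_eventually hB n
    exact ⟨Nat.find h, (Nat.find_spec h).1, (Nat.find_spec h).2,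
      fun y hy hny => Nat.find_min' h ⟨hy, hny⟩⟩
  choose p hpA hp hp_min using nextA
  choose q hqB hq hq_min using nextB
  obtain ⟨β, hβ0, hβs⟩ : ∃ β : ℕ → ℕ, β 0 = q 0 ∧ ∀ k, β (k + 1) = q (p (β k)) :=
    ⟨fun k => Nat.rec (q 0) (fun _ y => q (p y)) k, rfl, fun _ => rfl⟩
  have hβB (k : ℕ) : β k ∈ B := by
    cases k
    · exact hβ0 ▸ hqB _
    · exact hβs _ ▸ hqB _
  have hpβ (k : ℕ) : p (β k) < β (k + 1) := hβs k ▸ hq _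
  have hβ : StrictMono β := strictMono_nat_of_lt_succ fun k => (hp _).trans (hpβ k)
  obtain ⟨A', hA', hinjA⟩ := hU.2 _ hβ.finite_intervalIndex_fiber
  obtain ⟨B', hB', hinjB⟩ := hV.2 _ hβ.finite_intervalIndex_fiber
  have ha (i : ℕ) : ∃ x ∈ A, β i ≤ x ∧ x < β (i + 1) ∧
      ∀ y ∈ A ∩ A', β i ≤ y → y < β (i + 1) → y = x := by
    by_cases h : ∃ y ∈ A ∩ A', β i ≤ y ∧ y < β (i + 1)
    · obtain ⟨x, hx, hx1, hx2⟩ := h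
      refine ⟨x, hx.1, hx1, hx2, fun y hy hy1 hy2 => hinjA hy.2 hx.2 ?_⟩
      have h0 := hβ.monotone (Nat.zero_le i)
      have e1 := hβ.le_intervalIndex hy1
      have e2 := hβ.intervalIndex_lt (h0.trans hy1) hy2
      have e3 := hβ.le_intervalIndex hx1
      have e4 := hβ.intervalIndex_lt (h0.trans hx1) hx2
      omega
    · push Not at h
      exact ⟨p (β i), hpA _, (hp _).le, hpβ i, fun y hy hy1 hy2 =>
        absurd hy2 (h y hy hy1).not_gt⟩
  have hm (i : ℕ) : ∃ x ∈ B, β i ≤ x ∧ x < p (β i) ∧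
      ∀ y ∈ B ∩ B', β i ≤ y → y < β (i + 1) → y = x := by
    have hlow : ∀ y ∈ B, y < β (i + 1) → y < p (β i) := by
      intro y hy hyi
      by_contra! hle
      rcases hle.eq_or_lt with e | hlt
      · exact Set.disjoint_left.1 hAB (hpA (β i)) (e ▸ hy)
      · exact absurd (hβs i ▸ hq_min _ y hy hlt) hyi.not_ge
    by_cases h : ∃ y ∈ B ∩ B', β i ≤ y ∧ y < β (i + 1)
    · obtain ⟨x, hx, hx1, hx2⟩ := h
      refine ⟨x, hx.1, hx1, hlow x hx.1 hx2, fun y hy hy1 hy2 => hinjB hy.2 hx.2 ?_⟩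
      have h0 := hβ.monotone (Nat.zero_le i)
      have e1 := hβ.le_intervalIndex hy1
      have e2 := hβ.intervalIndex_lt (h0.trans hy1) hy2
      have e3 := hβ.le_intervalIndex hx1
      have e4 := hβ.intervalIndex_lt (h0.trans hx1) hx2
      omega
    · push Not at h
      exact ⟨β i, hβB i, le_rfl, hp _, fun y hy hy1 hy2 => absurd hy2 (h y hy hy1).not_gt⟩
  choose a haA ha1 ha2 ha3 using ha
  choose m hmB hm1 hm2 hm3 using hm
  refine ⟨a, m, haA, hmB, fun i => ⟨?_, (ha2 i).trans_le (hm1 _)⟩, ?_, ?_⟩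
  · have hlt : β i < a i := (ha1 i).lt_of_ne fun e =>
      Set.disjoint_left.1 hAB (haA i) (e ▸ hβB i)
    exact (hm2 i).trans_le (hp_min _ _ (haA i) hlt)
  · filter_upwards [hA, hA', hU.1.eventually_gt (β 0)] with x hx hx' hx0
    exact ⟨intervalIndex β x, (ha3 _ x ⟨hx, hx'⟩ (apply_intervalIndex_le hx0.le)
      (hβ.lt_intervalIndex_succ x)).symm⟩
  · filter_upwards [hB, hB', hV.1.eventually_gt (β 0)] with x hx hx' hx0
    exact ⟨intervalIndex β x, (hm3 _ x ⟨hx, hx'⟩ (apply_intervalIndex_le hx0.le)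
      (hβ.lt_intervalIndex_succ x)).symm⟩

/-- Non-isomorphic Ramsey ultrafilters admit alternating sequences generating members of both and
satisfying any sequence of relations that hold generically. -/
theorem IsRamseyUf.exists_alternating_of_eventually {U V : Ultrafilter ℕ} (hU : IsRamseyUf U)
    (hV : IsRamseyUf V) (hne : ¬ UfIso U V) {R : ℕ → ℕ → ℕ → Prop}
    (hR : ∀ m, ∀ᶠ a in U, ∀ᶠ b in V, R m a b) :
    ∃ a m : ℕ → ℕ, (∀ i, m i < a i ∧ a i < m (i + 1)) ∧ Set.range a ∈ U ∧ Set.range m ∈ V ∧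
      ∀ i, R (m i) (a i) (m (i + 1)) := by
  classical
  obtain ⟨A, hA, g, hg⟩ := hU.exists_pseudoIntersection _ hR
  have hS (n : ℕ) : ∀ᶠ b in V, ∀ m ∈ Finset.range (n + 1),
      (∀ᶠ b' in V, R m n b') → R m n b := by
    refine (eventually_all_finset _).2 fun m _ => ?_
    by_cases h : ∀ᶠ b' in V, R m n b'
    · exact h.mono fun b hb _ => hb
    · exact Eventually.of_forall fun b h' => absurd h' h
  obtain ⟨B, hB, g', hg'⟩ := hV.exists_pseudoIntersection _ hS
  let G : ℕ → ℕ := fun x => x + ∑ k ∈ Finset.range (x + 1), (g k + g' k)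
  have hG : Monotone G := fun x y hxy => add_le_add hxy
    (Finset.sum_le_sum_of_subset (Finset.range_mono (Nat.succ_le_succ hxy)))
  have hGle (x : ℕ) : g x + g' x ≤ G x :=
    (Finset.single_le_sum (f := fun k => g k + g' k) (fun _ _ => Nat.zero_le _)
      (Finset.self_mem_range_succ x)).trans (Nat.le_add_left _ _)
  obtain ⟨A', hA', B', hB', hfar⟩ := hU.isQPointUf.exists_far_apart hV.isQPointUf hne hG
    fun x => Nat.le_add_right _ _
  obtain ⟨a, m, ha, hm, hlt, hra, hrm⟩ := hU.isQPointUf.exists_alternating hV.isQPointUf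
    (inter_mem hA hA') (inter_mem hB hB')
    (Set.disjoint_left.2 fun x hx hx' => (hfar x hx.2 x hx'.2).1 rfl)
  refine ⟨a, m, hlt, hra, hrm, fun i => ?_⟩
  have h1 := (hfar (a i) (ha i).2 (m i) (hm i).2).2.2 (hlt i).1
  have h2 := (hfar (a i) (ha i).2 (m (i + 1)) (hm (i + 1)).2).2.1 (hlt i).2
  refine hg' (a i) _ (hm (i + 1)).1 ?_ (m i) ?_ (hg (m i) _ (ha i).1 ?_)
  · have := hGle (a i); omega
  · have := (hlt i).1; simp; omega
  · have := hGle (m i); omega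

/-- The least element of a finite set of naturals (`0` for the empty set). -/
noncomputable def blockMin (s : Finset ℕ) : ℕ := sInf (s : Set ℕ)

/-- The greatest element of a finite set of naturals (`0` for the empty set). -/
def blockMax (s : Finset ℕ) : ℕ := s.sup id

theorem blockMin_mem {s : Finset ℕ} (hs : s.Nonempty) : blockMin s ∈ s := Nat.sInf_mem hs

theorem blockMin_le {s : Finset ℕ} {x : ℕ} (hx : x ∈ s) : blockMin s ≤ x := Nat.sInf_le hx

theorem blockMax_mem {s : Finset ℕ} (hs : s.Nonempty) : blockMax s ∈ s := by
  obtain ⟨x, hx, h⟩ := s.exists_mem_eq_sup hs id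
  exact (show blockMax s = x from h) ▸ hx

theorem le_blockMax {s : Finset ℕ} {x : ℕ} (hx : x ∈ s) : x ≤ blockMax s :=
  Finset.le_sup (f := id) hx

theorem blockMin_eq_of_mem {s : Finset ℕ} {x : ℕ} (hx : x ∈ s) (h : ∀ y ∈ s, x ≤ y) :
    blockMin s = x :=
  (blockMin_le hx).antisymm (h _ (blockMin_mem ⟨x, hx⟩))

theorem blockMax_eq_of_mem {s : Finset ℕ} {x : ℕ} (hx : x ∈ s) (h : ∀ y ∈ s, y ≤ x) :
    blockMax s = x :=
  (h _ (blockMax_mem ⟨x, hx⟩)).antisymm (le_blockMax hx)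

theorem Finset.min'_eq_blockMin {s : Finset ℕ} (hs : s.Nonempty) : s.min' hs = blockMin s :=
  (blockMin_eq_of_mem (s.min'_mem hs) fun y hy => s.min'_le y hy).symm

theorem Finset.max'_eq_blockMax {s : Finset ℕ} (hs : s.Nonempty) : s.max' hs = blockMax s :=
  (blockMax_eq_of_mem (s.max'_mem hs) fun y hy => s.le_max' y hy).symm

theorem blockLt_of_blockMax_lt {s t : Finset ℕ} (h : blockMax s < blockMin t) : blockLt s t :=
  fun _ ha _ hb => (le_blockMax ha).trans_lt (h.trans_le (blockMin_le hb))

theorem blockMin_union {s t : Finset ℕ} (hs : s.Nonempty) (h : blockLt s t) :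
    blockMin (s ∪ t) = blockMin s :=
  blockMin_eq_of_mem (Finset.mem_union_left _ (blockMin_mem hs)) fun y hy =>
    (Finset.mem_union.1 hy).elim blockMin_le fun hy => (h _ (blockMin_mem hs) y hy).le

theorem blockMax_union {s t : Finset ℕ} (ht : t.Nonempty) (h : blockLt s t) :
    blockMax (s ∪ t) = blockMax t :=
  blockMax_eq_of_mem (Finset.mem_union_right _ (blockMax_mem ht)) fun y hy =>
    (Finset.mem_union.1 hy).elim (fun hy => (h y hy _ (blockMax_mem ht)).le) le_blockMax

theorem IsBlockSeq.blockLt {X : ℕ → Finset ℕ} (hX : IsBlockSeq X) {i j : ℕ} (hij : i < j) :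
    blockLt (X i) (X j) := by
  induction j, hij using Nat.le_induction with
  | base => exact (hX i).2
  | succ k hk ih =>
    intro a ha b hb
    have hm := blockMin_mem (hX k).1
    exact (ih a ha _ hm).trans ((hX k).2 _ hm b hb)

theorem IsBlockSeq.strictMono_blockMin {X : ℕ → Finset ℕ} (hX : IsBlockSeq X) :
    StrictMono fun i => blockMin (X i) :=
  fun i j hij => hX.blockLt hij _ (blockMin_mem (hX i).1) _ (blockMin_mem (hX j).1)

theorem IsBlockSeq.strictMono_blockMax {X : ℕ → Finset ℕ} (hX : IsBlockSeq X) :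
    StrictMono fun i => blockMax (X i) :=
  fun i j hij => hX.blockLt hij _ (blockMax_mem (hX i).1) _ (blockMax_mem (hX j).1)

section InUnions

variable {X : ℕ → Finset ℕ} {s t : Finset ℕ}

theorem inUnions_apply (X : ℕ → Finset ℕ) (i : ℕ) : InUnions X (X i) :=
  ⟨{i}, Finset.singleton_nonempty i, by simp⟩

theorem InUnions.union (hs : InUnions X s) (ht : InUnions X t) : InUnions X (s ∪ t) := by
  obtain ⟨I, hI, rfl⟩ := hs
  obtain ⟨J, -, rfl⟩ := ht
  exact ⟨I ∪ J, hI.mono Finset.subset_union_left, Finset.union_biUnion.symm⟩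

theorem Condensation.inUnions {Y : ℕ → Finset ℕ} (hYX : Condensation Y X) (hs : InUnions Y s) :
    InUnions X s := by
  obtain ⟨I, hI, rfl⟩ := hs
  choose J hJ hYJ using hYX
  refine ⟨I.biUnion J, hI.biUnion fun i _ => hJ i, ?_⟩
  rw [Finset.biUnion_biUnion]
  exact Finset.biUnion_congr rfl fun i _ => hYJ i

theorem IsBlockSeq.nonempty_of_inUnions (hX : IsBlockSeq X) (hs : InUnions X s) : s.Nonempty := by
  obtain ⟨I, hI, rfl⟩ := hs
  exact hI.biUnion fun i _ => (hX i).1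

theorem IsBlockSeq.exists_blockMin_eq (hX : IsBlockSeq X) (hs : InUnions X s) :
    ∃ i, blockMin (X i) = blockMin s := by
  have hne := hX.nonempty_of_inUnions hs
  obtain ⟨I, hI, rfl⟩ := hs
  obtain ⟨i, hi, hm⟩ := Finset.mem_biUnion.1 (blockMin_mem hne)
  exact ⟨i, blockMin_eq_of_mem hm fun y hy => blockMin_le (Finset.mem_biUnion.2 ⟨i, hi, hy⟩)⟩

theorem IsBlockSeq.exists_blockMax_eq (hX : IsBlockSeq X) (hs : InUnions X s) :
    ∃ i, blockMax (X i) = blockMax s := by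
  have hne := hX.nonempty_of_inUnions hs
  obtain ⟨I, hI, rfl⟩ := hs
  obtain ⟨i, hi, hm⟩ := Finset.mem_biUnion.1 (blockMax_mem hne)
  exact ⟨i, blockMax_eq_of_mem hm fun y hy => le_blockMax (Finset.mem_biUnion.2 ⟨i, hi, hy⟩)⟩

end InUnions

section Pair

variable {U V : Ultrafilter ℕ} {X : ℕ → Finset ℕ}

/-- The pairs `(min t, max t)` for `t ∈ [X]` are generic when the minima and maxima of the blocks
of `X` are. -/
theorem IsBlockSeq.eventually_exists_inUnions (hX : IsBlockSeq X) (hV : FreeUf V)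
    (hmin : (Set.range fun i => blockMin (X i)) ∈ U)
    (hmax : (Set.range fun i => blockMax (X i)) ∈ V) :
    ∀ᶠ a in U, ∀ᶠ b in V, ∃ t, InUnions X t ∧ blockMin t = a ∧ blockMax t = b := by
  filter_upwards [hmin]
  rintro _ ⟨i, rfl⟩
  filter_upwards [hmax, hV.eventually_gt (blockMax (X i))]
  rintro _ ⟨j, rfl⟩ hij
  have hlt := hX.blockLt (hX.strictMono_blockMax.lt_iff_lt.1 hij)
  exact ⟨X i ∪ X j, (inUnions_apply X i).union (inUnions_apply X j),
    blockMin_union (hX i).1 hlt, blockMax_union (hX j).1 hlt⟩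

theorem mem_FINinfPair_iff (hU : FreeUf U) (hV : FreeUf V) :
    X ∈ FINinfPair U V ↔ IsBlockSeq X ∧ (Set.range fun i => blockMin (X i)) ∈ U ∧
      (Set.range fun i => blockMax (X i)) ∈ V := by
  constructor
  · rintro ⟨hX, h⟩
    refine ⟨hX, ?_, ?_⟩
    · by_contra hmin
      obtain ⟨Y, hY, hYX, hY'⟩ := h _ (Ultrafilter.compl_mem_iff_notMem.2 hmin) _ univ_mem
      have := (hY' 0).1
      rw [Finset.min'_eq_blockMin] at this
      exact this (hX.exists_blockMin_eq (hYX 0))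
    · by_contra hmax
      obtain ⟨Y, hY, hYX, hY'⟩ := h _ univ_mem _ (Ultrafilter.compl_mem_iff_notMem.2 hmax)
      have := (hY' 0).2
      rw [Finset.max'_eq_blockMax] at this
      exact this (hX.exists_blockMax_eq (hYX 0))
  · rintro ⟨hX, hmin, hmax⟩
    refine ⟨hX, fun A hA B hB => ?_⟩
    have step (N : ℕ) : ∃ t, InUnions X t ∧ N < blockMin t ∧ blockMin t ∈ A ∧ blockMax t ∈ B := by
      obtain ⟨a, ha, haA, haN⟩ := ((hX.eventually_exists_inUnions hV hmin hmax).and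
        ((show ∀ᶠ a in U, a ∈ A from hA).and (hU.eventually_gt N))).exists
      obtain ⟨b, ⟨t, ht, rfl, rfl⟩, hbB⟩ := (ha.and (show ∀ᶠ b in V, b ∈ B from hB)).exists
      exact ⟨t, ht, haN, haA, hbB⟩
    choose F hFX hFN hFA hFB using step
    let Y : ℕ → Finset ℕ := fun n => Nat.rec (motive := fun _ => Finset ℕ) (F 0)
      (fun _ s => F (blockMax s)) n
    have hYF (n : ℕ) : ∃ N, Y n = F N := by cases n <;> exact ⟨_, rfl⟩
    have hY : IsBlockSeq Y := fun n => by
      obtain ⟨N, hN⟩ := hYF n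
      exact ⟨hN ▸ hX.nonempty_of_inUnions (hFX N),
        blockLt_of_blockMax_lt (hFN (blockMax (Y n)))⟩
    refine ⟨Y, hY, fun n => ?_, fun n => ?_⟩
    · obtain ⟨N, hN⟩ := hYF n
      exact hN ▸ hFX N
    · rw [Finset.min'_eq_blockMin, Finset.max'_eq_blockMax]
      obtain ⟨N, hN⟩ := hYF n
      exact hN ▸ ⟨hFA N, hFB N⟩

/-- If each predicate `P m` is satisfied by blocks with generic minimum and maximum, then some
member of the family is built from blocks satisfying `P m` for `m` the maximum of the previous
block. -/
theorem exists_mem_FINinfPair (hU : IsRamseyUf U) (hV : IsRamseyUf V) (hne : ¬ UfIso U V)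
    {P : ℕ → Finset ℕ → Prop} (hP : ∀ m, ∀ᶠ a in U, ∀ᶠ b in V,
      ∃ t : Finset ℕ, t.Nonempty ∧ P m t ∧ blockMin t = a ∧ blockMax t = b) :
    ∃ Y ∈ FINinfPair U V, ∃ m : ℕ → ℕ, StrictMono m ∧
      ∀ i, P (m i) (Y i) ∧ blockMax (Y i) = m (i + 1) := by
  obtain ⟨a, m, hlt, ha, hm, h⟩ := hU.exists_alternating_of_eventually hV hne hP
  choose Y hY hPY hmin hmax using h
  refine ⟨Y, ?_, m, strictMono_nat_of_lt_succ fun i => (hlt i).1.trans (hlt i).2,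
    fun i => ⟨hPY i, hmax i⟩⟩
  rw [mem_FINinfPair_iff hU.1 hV.1]
  refine ⟨fun i => ⟨hY i, blockLt_of_blockMax_lt ?_⟩, ?_, ?_⟩
  · rw [hmax, hmin]
    exact (hlt _).1
  · simpa only [hmin] using ha
  · filter_upwards [hm, hV.1.eventually_gt (m 0)]
    rintro _ ⟨i, rfl⟩ hi
    cases i with
    | zero => exact absurd hi (lt_irrefl _)
    | succ i => exact ⟨i, hmax i⟩

theorem mem_FINinfPair_of_condensationStar (hU : FreeUf U) (hV : FreeUf V) {Y : ℕ → Finset ℕ}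
    (hY : Y ∈ FINinfPair U V) (hX : IsBlockSeq X) (hYX : CondensationStar Y X) :
    X ∈ FINinfPair U V := by
  rw [mem_FINinfPair_iff hU hV] at hY ⊢
  obtain ⟨hYb, hmin, hmax⟩ := hY
  obtain ⟨m, hm⟩ := hYX
  refine ⟨hX, ?_, ?_⟩
  · filter_upwards [hmin, hU.eventually_gt m]
    rintro _ ⟨i, rfl⟩ hi
    exact hX.exists_blockMin_eq (hm i fun x hx => lt_of_lt_of_le hi (blockMin_le hx))
  · filter_upwards [hmax, hV.eventually_gt (blockMax (Y m))]
    rintro _ ⟨i, rfl⟩ hi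
    have hmi : m < i := hYb.strictMono_blockMax.lt_iff_lt.1 hi
    exact hX.exists_blockMax_eq (hm i fun x hx =>
      hmi.trans_le ((hYb.strictMono_blockMin.id_le i).trans (blockMin_le hx)))

theorem IsBlockSeq.condensationStar_of_finite_ne {Y : ℕ → Finset ℕ} (hY : IsBlockSeq Y)
    (h : {n | X n ≠ Y n}.Finite) : CondensationStar Y X := by
  refine ⟨h.toFinset.sup fun n => blockMax (Y n), fun i hi => ?_⟩
  have hi' : X i = Y i := by
    by_contra hne
    have := hi _ (blockMax_mem (hY i).1)
    exact this.not_ge (Finset.le_sup (f := fun n => blockMax (Y n)) (h.mem_toFinset.2 hne))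
  exact hi' ▸ inUnions_apply X i

theorem exists_condensationStar_of_condensation (hU : IsRamseyUf U) (hV : IsRamseyUf V)
    (hne : ¬ UfIso U V) (f : ℕ → ℕ → Finset ℕ) (hf : ∀ n, f n ∈ FINinfPair U V)
    (hdesc : ∀ n, Condensation (f (n + 1)) (f n)) :
    ∃ X ∈ FINinfPair U V, ∀ n, CondensationStar X (f n) := by
  have hP (m : ℕ) : ∀ᶠ a in U, ∀ᶠ b in V, ∃ t : Finset ℕ, t.Nonempty ∧ InUnions (f m) t ∧
      blockMin t = a ∧ blockMax t = b := by
    obtain ⟨hb, hmin, hmax⟩ := (mem_FINinfPair_iff hU.1 hV.1).1 (hf m)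
    exact (hb.eventually_exists_inUnions hV.1 hmin hmax).mono fun a ha => ha.mono
      fun b ⟨t, ht, h⟩ => ⟨t, hb.nonempty_of_inUnions ht, ht, h⟩
  obtain ⟨X, hX, m, hm, h⟩ := exists_mem_FINinfPair hU hV hne hP
  refine ⟨X, hX, fun n => ⟨m n, fun i hi => ?_⟩⟩
  have hmono : ∀ k, n ≤ k → ∀ s, InUnions (f k) s → InUnions (f n) s := by
    intro k hk
    induction k, hk using Nat.le_induction with
    | base => exact fun s hs => hs
    | succ k hk ih => exact fun s hs => ih s ((hdesc k).inUnions hs)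
  have hni : m n < m (i + 1) := (h i).2 ▸ hi _ (blockMax_mem (hX.1 i).1)
  have : n ≤ i := Nat.le_of_lt_succ (hm.lt_iff_lt.1 hni)
  exact hmono _ (this.trans (hm.id_le i)) _ (h i).1

/-- The semigroup of finite sets under union. -/
abbrev unionSemigroup : Semigroup (Finset ℕ) where
  mul := (· ∪ ·)
  mul_assoc := Finset.union_assoc

attribute [local instance] unionSemigroup Ultrafilter.mul Ultrafilter.semigroup

theorem eventually_blockLt {p : Ultrafilter (Finset ℕ)} (hU : FreeUf U) (hp : p.map blockMin = U)
    (s : Finset ℕ) : ∀ᶠ t in p, t.Nonempty ∧ blockLt s t := by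
  have h : ∀ᶠ t in p, blockMax s < blockMin t := by
    have := hU.eventually_gt (blockMax s)
    rwa [← hp] at this
  refine h.mono fun t ht => ⟨?_, blockLt_of_blockMax_lt ht⟩
  rw [Finset.nonempty_iff_ne_empty]
  rintro rfl
  simp [blockMin] at ht

/-- There is an idempotent ultrafilter on finite sets whose images under minimum and maximum are
prescribed, and which contains the unions of the blocks of a given member of the family. -/
theorem exists_idempotent_map_blockMin_blockMax (hU : FreeUf U) (hV : FreeUf V)
    (hX : X ∈ FINinfPair U V) :
    ∃ p : Ultrafilter (Finset ℕ), p.map blockMin = U ∧ p.map blockMax = V ∧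
      (∀ᶠ s in p, InUnions X s) ∧
      ∀ Q : Finset ℕ → Prop, (∀ᶠ s in p, Q s) ↔ ∀ᶠ s in p, ∀ᶠ t in p, Q (s ∪ t) := by
  let T : Set (Ultrafilter (Finset ℕ)) :=
    {p | p.map blockMin = U ∧ p.map blockMax = V ∧ {s | InUnions X s} ∈ p}
  have hT : T = (⋂ A ∈ U, {p | blockMin ⁻¹' A ∈ p}) ∩ ((⋂ B ∈ V, {p | blockMax ⁻¹' B ∈ p}) ∩
      {p | {s | InUnions X s} ∈ p}) := by
    ext p
    simp only [T, Set.mem_ofPred_eq, Set.mem_inter_iff, Set.mem_iInter]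
    refine and_congr ⟨?_, fun h => ?_⟩ (and_congr_left' ⟨?_, fun h => ?_⟩)
    · rintro rfl A hA
      exact hA
    · exact Ultrafilter.eq_of_le h
    · rintro rfl A hA
      exact hA
    · exact Ultrafilter.eq_of_le h
  have hclosed : IsClosed T := by
    rw [hT]
    exact (isClosed_biInter fun A _ => ultrafilter_isClosed_basic _).inter
      ((isClosed_biInter fun B _ => ultrafilter_isClosed_basic _).inter
        (ultrafilter_isClosed_basic _))
  have hne : T.Nonempty := by
    obtain ⟨hb, hmin, hmax⟩ := (mem_FINinfPair_iff hU hV).1 hX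
    let F : Filter (Finset ℕ) :=
      𝓟 {s | InUnions X s} ⊓ (comap blockMin U ⊓ comap blockMax V)
    have hF : F.NeBot := by
      rw [← forall_mem_nonempty_iff_neBot]
      intro S hS
      obtain ⟨S₁, hS₁, S', ⟨S₂, ⟨A, hA, hAS⟩, S₃, ⟨B, hB, hBS⟩, rfl⟩, rfl⟩ := hS
      obtain ⟨a, ha, haA⟩ := ((hb.eventually_exists_inUnions hV hmin hmax).and
        (show ∀ᶠ a in U, a ∈ A from hA)).exists
      obtain ⟨b, ⟨t, ht, rfl, rfl⟩, hbB⟩ := (ha.and (show ∀ᶠ b in V, b ∈ B from hB)).exists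
      exact ⟨t, hS₁ ht, hAS haA, hBS hbB⟩
    have hle : ↑(Ultrafilter.of F) ≤ F := Ultrafilter.of_le F
    refine ⟨Ultrafilter.of F, Ultrafilter.eq_of_le ?_, Ultrafilter.eq_of_le ?_, ?_⟩
    · exact map_le_iff_le_comap.2 (hle.trans (inf_le_right.trans inf_le_left))
    · exact map_le_iff_le_comap.2 (hle.trans (inf_le_right.trans inf_le_right))
    · exact hle (mem_inf_of_left (mem_principal_self _))
  have hmul : ∀ᵉ (p ∈ T) (q ∈ T), p * q ∈ T := by
    rintro p ⟨hp₁, hp₂, hp₃⟩ q ⟨hq₁, hq₂, hq₃⟩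
    refine ⟨Ultrafilter.eq_of_le fun A hA => ?_, Ultrafilter.eq_of_le fun B hB => ?_, ?_⟩
    · have h1 : ∀ᶠ s in p, blockMin s ∈ A := by rwa [← hp₁] at hA
      change ∀ᶠ s in p, ∀ᶠ t in q, blockMin (s ∪ t) ∈ A
      filter_upwards [h1, eventually_blockLt hU hp₁ ∅] with s hs hs'
      filter_upwards [eventually_blockLt hU hq₁ s] with t ht
      rwa [blockMin_union hs'.1 ht.2]
    · have h1 : ∀ᶠ t in q, blockMax t ∈ B := by rwa [← hq₂] at hB
      change ∀ᶠ s in p, ∀ᶠ t in q, blockMax (s ∪ t) ∈ B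
      refine Eventually.of_forall fun s => ?_
      filter_upwards [h1, eventually_blockLt hU hq₁ s] with t ht ht'
      rwa [blockMax_union ht'.1 ht'.2]
    · change ∀ᶠ s in p, ∀ᶠ t in q, InUnions X (s ∪ t)
      filter_upwards [hp₃] with s hs
      filter_upwards [hq₃] with t ht
      exact InUnions.union hs ht
  obtain ⟨p, ⟨hp₁, hp₂, hp₃⟩, hpp⟩ := exists_idempotent_in_compact_subsemigroup
    Ultrafilter.continuous_mul_left T hne hclosed.isCompact hmul
  refine ⟨p, hp₁, hp₂, hp₃, fun Q => ?_⟩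
  conv_lhs => rw [← hpp]
  exact Iff.rfl

theorem exists_monochromatic_condensation (hU : IsRamseyUf U) (hV : IsRamseyUf V)
    (hne : ¬ UfIso U V) (hX : X ∈ FINinfPair U V) (c : Finset ℕ → Fin 2) :
    ∃ Y ∈ FINinfPair U V, Condensation Y X ∧ ∃ j, ∀ s, InUnions Y s → c s = j := by
  obtain ⟨p, hp₁, hp₂, hpX, hpp⟩ := exists_idempotent_map_blockMin_blockMax hU.1 hV.1 hX
  obtain ⟨j, hj⟩ : ∃ j, ∀ᶠ s in p, c s = j :=
    Ultrafilter.eventually_exists_iff.1 (Eventually.of_forall fun s => ⟨c s, rfl⟩)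
  let D : Finset ℕ → Prop := fun s => InUnions X s ∧ c s = j
  have hD : ∀ᶠ s in p, D s := hpX.and hj
  let D' : Finset ℕ → Prop := fun s => D s ∧ ∀ᶠ t in p, D (s ∪ t)
  have hD' : ∀ᶠ s in p, D' s := hD.and ((hpp D).1 hD)
  have hDD' (s : Finset ℕ) (hs : D' s) : ∀ᶠ t in p, D' (s ∪ t) := by
    have := (hpp fun t => D (s ∪ t)).1 hs.2
    filter_upwards [hs.2, this] with t ht ht'
    exact ⟨ht, by simpa only [Finset.union_assoc] using ht'⟩
  let E : ℕ → Finset ℕ → Prop := fun m t =>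
    D' t ∧ ∀ s ∈ (Finset.range (m + 1)).powerset, D' s → D' (s ∪ t)
  have hE (m : ℕ) : ∀ᶠ t in p, E m t := by
    refine hD'.and ((eventually_all_finset _).2 fun s _ => ?_)
    by_cases hs : D' s
    · exact (hDD' s hs).mono fun t ht _ => ht
    · exact Eventually.of_forall fun t h => absurd h hs
  have hP (m : ℕ) : ∀ᶠ a in U, ∀ᶠ b in V, ∃ t : Finset ℕ, t.Nonempty ∧ E m t ∧
      blockMin t = a ∧ blockMax t = b := by
    rw [← hp₁, ← hp₂]
    change ∀ᶠ s in p, ∀ᶠ t in p, ∃ u : Finset ℕ, u.Nonempty ∧ E m u ∧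
      blockMin u = blockMin s ∧ blockMax u = blockMax t
    filter_upwards [(hpp _).1 (hE m), eventually_blockLt hU.1 hp₁ ∅] with s hs hs'
    filter_upwards [hs, eventually_blockLt hU.1 hp₁ s] with t ht ht'
    exact ⟨s ∪ t, hs'.1.mono Finset.subset_union_left, ht, blockMin_union hs'.1 ht'.2,
      blockMax_union ht'.1 ht'.2⟩
  obtain ⟨Y, hY, m, hm, h⟩ := exists_mem_FINinfPair hU hV hne hP
  have hYD (I : Finset ℕ) : I.Nonempty → D' (I.biUnion Y) := by
    induction I using Finset.induction_on_max with
    | empty => exact fun h => absurd h Finset.not_nonempty_empty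
    | insert k I hk ih =>
      intro _
      rw [Finset.biUnion_insert, Finset.union_comm]
      rcases I.eq_empty_or_nonempty with rfl | hI
      · simpa using (h k).1.1
      · refine (h k).1.2 _ (Finset.mem_powerset.2 fun x hx => ?_) (ih hI)
        obtain ⟨i, hi, hxi⟩ := Finset.mem_biUnion.1 hx
        have : x ≤ m (i + 1) := (h i).2 ▸ le_blockMax hxi
        exact Finset.mem_range_succ_iff.2 (this.trans (hm.monotone (hk i hi)))
  refine ⟨Y, hY, fun n => (h n).1.1.1.1, j, ?_⟩
  rintro _ ⟨I, hI, rfl⟩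
  exact (hYD I hI).1.2

theorem singleton_mem_FINinfPair (hU : FreeUf U) (hV : FreeUf V) :
    (fun i => {i}) ∈ FINinfPair U V := by
  refine (mem_FINinfPair_iff hU hV).2 ⟨fun i => ⟨Finset.singleton_nonempty i, ?_⟩, ?_, ?_⟩
  · simp [blockLt]
  · simp only [blockMin, Finset.coe_singleton, csInf_singleton, Set.range_id']
    exact univ_mem
  · simp only [blockMax, Finset.sup_singleton, id_eq, Set.range_id']
    exact univ_mem

end Pair

/-- Mildenberger: `FIN^[∞](⟨U0,U1⟩)` is Matet-adequate for non-isomorphic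
Ramsey ultrafilters `U0, U1`. -/
theorem fininfPair_matetAdequate (U0 U1 : Ultrafilter ℕ)
    (h0 : IsRamseyUf U0) (h1 : IsRamseyUf U1) (hne : ¬ UfIso U0 U1) :
    MatetAdequate (FINinfPair U0 U1) := by
  exact ⟨⟨_, singleton_mem_FINinfPair h0.1 h1.1⟩, fun _ hX => hX.1,
    fun Y hY X hX hfin => mem_FINinfPair_of_condensationStar h0.1 h1.1 hY hX
      (hY.1.condensationStar_of_finite_ne hfin),
    fun Y hY X hX => mem_FINinfPair_of_condensationStar h0.1 h1.1 hY hX,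
    exists_condensationStar_of_condensation h0 h1 hne,
    fun X hX c => exists_monochromatic_condensation h0 h1 hne hX c⟩
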